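/- (Corollary of Theorems 4.3 and 6.2.) Let F be a field of characteristic zero and A a #-superalgebra over F which is a PI-algebra. Then there exist integers d₁,l₁,d₂,l₂,d₃,l₃,d₄,l₄ ≥ 0 such that A satisfies the Amitsur #-superidentity of rank ⟨d,l⟩ = (d₁,l₁;d₂,l₂;d₃,l₃;d₄,l₄). -/

import Mathlib

open scoped Classical

noncomputable section

namespace SSA

/-- Ordered product of a list of elements of a (possibly non-unital) multiplicative
structure; `0` for the empty list. -/
def listProd {A : Type*} [Mul A] [Zero A] : List A → A
  | [] => 0
  | [a] => a
  | a :: b :: l => a * listProd (b :: l)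

/-- The ordered product `a 0 * a 1 * ⋯ * a (n-1)`. -/
def finProd {A : Type*} [Mul A] [Zero A] {n : ℕ} (a : Fin n → A) : A :=
  listProd (List.ofFn a)

/-- `A` is a PI-algebra over `F`: it satisfies a nontrivial multilinear polynomial identity. -/
def IsPI (F A : Type*) [Field F] [NonUnitalRing A] [Module F A] : Prop :=
  ∃ n : ℕ, 1 ≤ n ∧ ∃ c : Equiv.Perm (Fin n) → F, c ≠ 0 ∧
    ∀ a : Fin n → A, ∑ σ : Equiv.Perm (Fin n), c σ • finProd (fun i => a (σ i)) = 0

variable (F : Type*) [Field F]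

/-- A `#`-superalgebra: an associative (not necessarily unital) `F`-algebra `A` with a
`ℤ₂`-grading `A = A₀ ⊕ A₁` and a linear map `#` which is a graded involution or a
superinvolution. -/
structure SuperAlg (A : Type*) [NonUnitalRing A] [Module F A]
    [SMulCommClass F A A] [IsScalarTower F A A] : Type _ where
  A0 : Submodule F A
  A1 : Submodule F A
  sup_eq_top : A0 ⊔ A1 = ⊤
  inf_eq_bot : A0 ⊓ A1 = ⊥
  mul_mem00 : ∀ a ∈ A0, ∀ b ∈ A0, a * b ∈ A0
  mul_mem01 : ∀ a ∈ A0, ∀ b ∈ A1, a * b ∈ A1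
  mul_mem10 : ∀ a ∈ A1, ∀ b ∈ A0, a * b ∈ A1
  mul_mem11 : ∀ a ∈ A1, ∀ b ∈ A1, a * b ∈ A0
  sharp : A →ₗ[F] A
  sharp_sharp : ∀ a, sharp (sharp a) = a
  sharp_mem0 : ∀ a ∈ A0, sharp a ∈ A0
  sharp_mem1 : ∀ a ∈ A1, sharp a ∈ A1
  gradedInvolution_or_superInvolution :
    (∀ a b : A, sharp (a * b) = sharp b * sharp a) ∨
    ((∀ a ∈ A0, ∀ b ∈ A0, sharp (a * b) = sharp b * sharp a) ∧
     (∀ a ∈ A0, ∀ b ∈ A1, sharp (a * b) = sharp b * sharp a) ∧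
     (∀ a ∈ A1, ∀ b ∈ A0, sharp (a * b) = sharp b * sharp a) ∧
     (∀ a ∈ A1, ∀ b ∈ A1, sharp (a * b) = -(sharp b * sharp a)))

variable {F}

/-- The four components `A₀⁺, A₀⁻, A₁⁺, A₁⁻` of a `#`-superalgebra (types `0,1,2,3`). -/
def SuperAlg.comp {A : Type*} [NonUnitalRing A] [Module F A]
    [SMulCommClass F A A] [IsScalarTower F A A] (S : SuperAlg F A) (i : Fin 4) :
    Submodule F A :=
  (if i = 0 ∨ i = 1 then S.A0 else S.A1) ⊓
    LinearMap.ker (S.sharp - (if i = 0 ∨ i = 2 then (1 : F) else (-1 : F)) • LinearMap.id)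

/-- A partition of `k`, given by its (non-increasing) sequence of row lengths. -/
structure NPartition (k : ℕ) where
  part : ℕ → ℕ
  antitone : Antitone part
  part_eq_zero : ∀ i, k ≤ i → part i = 0
  sum_eq : ∑ i ∈ Finset.range k, part i = k

/-- The cells of the Young diagram of a partition. -/
abbrev NPartition.Cell {k : ℕ} (μ : NPartition k) : Type :=
  {p : ℕ × ℕ // p.2 < μ.part p.1}

/-- A Young tableau of shape `μ ⊢ k`: a bijective filling of the diagram with `1,…,k`. -/
abbrev YTableau {k : ℕ} (μ : NPartition k) : Type :=
  Fin k ≃ μ.Cell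

/-- The row stabilizer of a tableau. -/
def rowStab {k : ℕ} {μ : NPartition k} (T : YTableau μ) : Set (Equiv.Perm (Fin k)) :=
  {π | ∀ a, (T (π a)).1.1 = (T a).1.1}

/-- The column stabilizer of a tableau. -/
def colStab {k : ℕ} {μ : NPartition k} (T : YTableau μ) : Set (Equiv.Perm (Fin k)) :=
  {π | ∀ a, (T (π a)).1.2 = (T a).1.2}

/-- A standard Young tableau: entries increase along rows and down columns. -/
def YTableau.Standard {k : ℕ} {μ : NPartition k} (T : YTableau μ) : Prop :=
  ∀ c c' : μ.Cell,
    ((c.1.1 = c'.1.1 ∧ c.1.2 < c'.1.2) ∨ (c.1.2 = c'.1.2 ∧ c.1.1 < c'.1.1)) →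
      T.symm c < T.symm c'

/-- The partition `μ` lies in the infinite hook `H(d,l)`, i.e. `μ_{d+1} ≤ l`. -/
def InHook (d l : ℕ) {k : ℕ} (μ : NPartition k) : Prop :=
  μ.part d ≤ l

variable (F)

/-- The Young symmetrizer `e_T = ∑_{σ ∈ R_T, τ ∈ C_T} sgn(τ)·στ`. -/
def youngSym {k : ℕ} {μ : NPartition k} (T : YTableau μ) :
    MonoidAlgebra F (Equiv.Perm (Fin k)) :=
  ∑ σ ∈ Finset.univ.filter (· ∈ rowStab T),
    ∑ τ ∈ Finset.univ.filter (· ∈ colStab T),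
      (Equiv.Perm.sign τ : ℤ) • MonoidAlgebra.single (σ * τ) (1 : F)

/-- The function `σ ↦ trace of left multiplication by `σ` on the left ideal generated by `e`;
for `e` a Young symmetrizer of shape `λ` this is the irreducible character `χ_λ`. -/
def idealChar {k : ℕ} (e : MonoidAlgebra F (Equiv.Perm (Fin k)))
    (σ : Equiv.Perm (Fin k)) : F :=
  LinearMap.trace F _
    ((LinearMap.mulLeft F (MonoidAlgebra.single σ (1 : F))).restrict
      (p := (Submodule.span (MonoidAlgebra F (Equiv.Perm (Fin k))) {e}).restrictScalars F)
      (q := (Submodule.span (MonoidAlgebra F (Equiv.Perm (Fin k))) {e}).restrictScalars F)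
      (fun x hx => by
        simp only [Submodule.restrictScalars_mem] at hx ⊢
        simpa [smul_eq_mul] using
          (Submodule.span (MonoidAlgebra F (Equiv.Perm (Fin k))) {e}).smul_mem
            (MonoidAlgebra.single σ (1 : F)) hx))

/-- The set of variables for a multidegree `⟨n⟩ = (n₁,n₂,n₃,n₄)`: the disjoint union of
`Fin n₁, …, Fin n₄`, a type-`i` variable being evaluated in the `i`-th component. -/
abbrev MVar (n : Fin 4 → ℕ) : Type :=
  Σ i : Fin 4, Fin (n i)

/-- The group `S⟨n⟩ = S_{n₁} × S_{n₂} × S_{n₃} × S_{n₄}`. -/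
abbrev MGroup (n : Fin 4 → ℕ) : Type :=
  ∀ i : Fin 4, Equiv.Perm (Fin (n i))

/-- The space `P⟨n⟩` of multilinear `#`-superpolynomials: a function `c` represents
`∑_{ord} c(ord) x_{ord(1)} ⋯ x_{ord(n)}`. -/
abbrev MPoly (F : Type*) (n : Fin 4 → ℕ) : Type _ :=
  (Fin (∑ i, n i) ≃ MVar n) → F

variable {F} in
/-- The (left) action of `S⟨n⟩` on `P⟨n⟩` by relabeling the type-`i` variable indices. -/
def permMPoly {n : Fin 4 → ℕ} (g : MGroup n) (c : MPoly F n) : MPoly F n :=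
  fun ord => c (ord.trans (Equiv.sigmaCongrRight fun i => ((g i)⁻¹ : Equiv.Perm (Fin (n i)))))

variable {F} in
/-- `c ∈ P⟨n⟩` is a `#`-superidentity of `A`: every admissible evaluation
(type-`i` variables in the `i`-th component) vanishes. -/
def MIsIdentity {A : Type*} [NonUnitalRing A] [Module F A]
    [SMulCommClass F A A] [IsScalarTower F A A] (S : SuperAlg F A)
    {n : Fin 4 → ℕ} (c : MPoly F n) : Prop :=
  ∀ a : MVar n → A, (∀ v : MVar n, a v ∈ S.comp v.1) →
    ∑ ord : Fin (∑ i, n i) ≃ MVar n, c ord • finProd (fun j => a (ord j)) = 0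

/-- The Young symmetrizer `e_{T⟨μ⟩}` of a Young multitableau, as an element of
`FS⟨n⟩ = MonoidAlgebra F S⟨n⟩`. -/
def multiYoungSym {n : Fin 4 → ℕ} {μ : ∀ i : Fin 4, NPartition (n i)}
    (T : ∀ i : Fin 4, YTableau (μ i)) : MonoidAlgebra F (MGroup n) :=
  ∑ σ ∈ Finset.univ.filter (fun σ : MGroup n => ∀ i, σ i ∈ rowStab (T i)),
    ∑ τ ∈ Finset.univ.filter (fun τ : MGroup n => ∀ i, τ i ∈ colStab (T i)),
      (∏ i, (Equiv.Perm.sign (τ i) : ℤ)) • MonoidAlgebra.single (σ * τ) (1 : F)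

/-- The element `e_{T⟨μ⟩} · f`, for `f ∈ P⟨n⟩`. -/
def symAct {n : Fin 4 → ℕ} {μ : ∀ i : Fin 4, NPartition (n i)}
    (T : ∀ i : Fin 4, YTableau (μ i)) (c : MPoly F n) : MPoly F n :=
  ∑ σ ∈ Finset.univ.filter (fun σ : MGroup n => ∀ i, σ i ∈ rowStab (T i)),
    ∑ τ ∈ Finset.univ.filter (fun τ : MGroup n => ∀ i, τ i ∈ colStab (T i)),
      (∏ i, (Equiv.Perm.sign (τ i) : ℤ)) • permMPoly (σ * τ) c
variable {F} in
/-- `A` satisfies the Amitsur `#`-superidentity of rank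
`⟨d,l⟩ = (d₁,l₁;d₂,l₂;d₃,l₃;d₄,l₄)` (here `dᵢ = d i`, `lᵢ = l i`): for each type `i`,
with `kᵢ = (dᵢ+1)(lᵢ+1)`, `χᵢ` the irreducible character of the rectangular partition
`((lᵢ+1)^{dᵢ+1}) ⊢ kᵢ` (realized as the trace function on the left ideal generated by a
Young symmetrizer of that shape), every evaluation
`∑_{σ ∈ S_{kᵢ}} χᵢ(σ) b₁ a_{σ(1)} b₂ a_{σ(2)} ⋯ b_{kᵢ} a_{σ(kᵢ)} b_{kᵢ+1}`
vanishes, where `a₁,…,a_{kᵢ}` run over the `i`-th component and each `bⱼ` is either an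
element of one of the four components or omitted. -/
def SatisfiesAmitsur {A : Type*} [NonUnitalRing A] [Module F A]
    [SMulCommClass F A A] [IsScalarTower F A A] (S : SuperAlg F A)
    (d l : Fin 4 → ℕ) : Prop :=
  ∀ i : Fin 4, ∀ ν : NPartition ((d i + 1) * (l i + 1)),
    (∀ j, j < d i + 1 → ν.part j = l i + 1) →
    ∀ T : YTableau ν,
    ∀ a : Fin ((d i + 1) * (l i + 1)) → A, (∀ j, a j ∈ S.comp i) →
    ∀ b : Fin ((d i + 1) * (l i + 1) + 1) → Option A,
      (∀ j, ∀ x ∈ b j, ∃ t : Fin 4, x ∈ S.comp t) →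
      ∑ σ : Equiv.Perm (Fin ((d i + 1) * (l i + 1))),
        idealChar F (youngSym F T) σ •
          listProd ((List.ofFn fun j : Fin ((d i + 1) * (l i + 1)) =>
              (b j.castSucc).toList ++ [a (σ j)]).flatten ++ (b (Fin.last _)).toList) = 0

section RepPart

variable {G : Type*} [Group G] [Fintype G]

theorem trace_kill {W : Type*} [AddCommGroup W] [Module F W]
    (ρ : Representation F G W) (V : Submodule F W)
    (hV : ∀ g, ∀ v ∈ V, ρ g v ∈ V)
    (e : MonoidAlgebra F G) (he : ∀ v ∈ V, ρ.asAlgebraHom e v = 0)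
    (I : Submodule F (MonoidAlgebra F G))
    (hI : ∀ x ∈ I, ∃ y, x = y * e)
    (L : G → (I →ₗ[F] I)) (hL : ∀ g x, ((L g x : I) : MonoidAlgebra F G)
      = MonoidAlgebra.single g (1 : F) * (x : MonoidAlgebra F G))
    (v : W) (hv : v ∈ V) :
    ∑ g : G, LinearMap.trace F I (L g⁻¹) • ρ g v = 0 := by
  have : FiniteDimensional F (MonoidAlgebra F G) :=
    Module.Finite.equiv (MonoidAlgebra.coeffLinearEquiv (M := G) (S := F) F).symm
  obtain ⟨P, hP⟩ := LinearMap.exists_leftInverse_of_injective I.subtype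
    (by simp)
  have hP' : ∀ x : I, P x = x := fun x => by
    have := LinearMap.congr_fun hP x
    simpa using this
  let bs := Module.finBasis F I
  let f : Fin (Module.finrank F I) → (MonoidAlgebra F G →ₗ[F] F) := fun i => bs.coord i ∘ₗ P
  let Tm : Fin (Module.finrank F I) → (MonoidAlgebra F G →ₗ[F] W) := fun i =>
    ∑ g : G, ((f i) ∘ₗ (LinearMap.mulLeft F (MonoidAlgebra.single g⁻¹ (1 : F)))).smulRight (ρ g v)
  have hTm : ∀ i x, Tm i x = ∑ g : G, f i (MonoidAlgebra.single g⁻¹ 1 * x) • ρ g v := by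
    intro i x
    simp [Tm]
  have heq : ∀ i x, Tm i x = ρ.asAlgebraHom x (Tm i 1) := by
    intro i x
    induction x using MonoidAlgebra.induction_linear with
    | zero => simp
    | add x y hx hy => simp [hx, hy]
    | single h r =>
      rw [hTm, hTm, map_sum, ← (Equiv.mulLeft h).sum_comp]
      refine Finset.sum_congr rfl fun g _ => ?_
      simp only [Equiv.coe_mulLeft, mul_inv_rev, MonoidAlgebra.single_mul_single, one_mul, mul_one,
        inv_mul_cancel_right, Representation.asAlgebraHom_single, map_smul, map_mul,
        LinearMap.smul_apply, Module.End.mul_apply]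
      have : (MonoidAlgebra.single g⁻¹ r : MonoidAlgebra F G)
          = r • MonoidAlgebra.single g⁻¹ 1 := by simp
      rw [this, map_smul, smul_comm, smul_smul, smul_eq_mul]
      simp
  have hT1 : ∀ i, Tm i 1 ∈ V := by
    intro i
    rw [hTm]
    exact V.sum_mem fun g _ => V.smul_mem _ (hV g v hv)
  have hz : ∀ i, ∀ x ∈ I, Tm i x = 0 := by
    intro i x hx
    obtain ⟨y, rfl⟩ := hI x hx
    rw [heq, map_mul, Module.End.mul_apply, he _ (hT1 i), map_zero]
  have htr : ∀ g : G, LinearMap.trace F I (L g⁻¹)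
      = ∑ i, f i (MonoidAlgebra.single g⁻¹ 1 * (bs i : MonoidAlgebra F G)) := by
    intro g
    rw [LinearMap.trace_eq_matrix_trace F bs, Matrix.trace]
    refine Finset.sum_congr rfl fun i _ => ?_
    rw [Matrix.diag_apply, LinearMap.toMatrix_apply, ← hL]
    simp [f, hP']
  simp_rw [htr, Finset.sum_smul]
  rw [Finset.sum_comm]
  refine Finset.sum_eq_zero fun i _ => ?_
  rw [← hTm]
  exact hz i _ (bs i).2

end RepPart

theorem idealChar_kill {k : ℕ} {W : Type*} [AddCommGroup W] [Module F W]
    (ρ : Representation F (Equiv.Perm (Fin k)) W) (V : Submodule F W)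
    (hV : ∀ g, ∀ v ∈ V, ρ g v ∈ V)
    (e : MonoidAlgebra F (Equiv.Perm (Fin k))) (he : ∀ v ∈ V, ρ.asAlgebraHom e v = 0)
    (v : W) (hv : v ∈ V) :
    ∑ g, idealChar F e g • ρ g v = 0 := by
  let I := (Submodule.span (MonoidAlgebra F (Equiv.Perm (Fin k))) {e}).restrictScalars F
  have hmem : ∀ (g : Equiv.Perm (Fin k)), ∀ x ∈ I,
      LinearMap.mulLeft F (MonoidAlgebra.single g (1 : F)) x ∈ I := by
    intro g x hx
    simp only [I, Submodule.restrictScalars_mem] at hx ⊢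
    simpa [smul_eq_mul] using
          (Submodule.span (MonoidAlgebra F (Equiv.Perm (Fin k))) {e}).smul_mem
            (MonoidAlgebra.single g (1 : F)) hx
  let L : Equiv.Perm (Fin k) → (I →ₗ[F] I) := fun g =>
    (LinearMap.mulLeft F (MonoidAlgebra.single g (1 : F))).restrict (hmem g)
  have hL : ∀ g (x : I), ((L g x : I) : MonoidAlgebra F (Equiv.Perm (Fin k))) =
      MonoidAlgebra.single g (1 : F) * (x : MonoidAlgebra F (Equiv.Perm (Fin k))) :=
    fun g x => rfl
  have hchar : ∀ g, idealChar F e g = LinearMap.trace F I (L g) := fun g => rfl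
  have hmul : ∀ g h, L (g * h) = L g * L h := by
    intro g h
    ext1 x
    apply Subtype.ext
    rw [Module.End.mul_apply, hL, hL, hL, ← mul_assoc, MonoidAlgebra.single_mul_single, mul_one]
  have hone : L 1 = 1 := by
    ext1 x
    apply Subtype.ext
    rw [hL, Module.End.one_apply, ← MonoidAlgebra.one_def, one_mul]
  have hinv : ∀ g, LinearMap.trace F I (L g) = LinearMap.trace F I (L g⁻¹) := by
    intro g
    have : IsConj g g⁻¹ := by
      rw [Equiv.Perm.isConj_iff_cycleType_eq, Equiv.Perm.cycleType_inv]
    obtain ⟨c, hc⟩ := isConj_iff.1 this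
    rw [← hc, hmul, hmul, LinearMap.trace_mul_comm, ← mul_assoc, ← hmul, inv_mul_cancel, hone,
      one_mul]
  rw [Finset.sum_congr rfl fun g _ => by rw [hchar g, hinv g]]
  refine trace_kill F ρ V hV e he I ?_ L hL v hv
  intro x hx
  obtain ⟨y, hy⟩ := Submodule.mem_span_singleton.1
    ((Submodule.restrictScalars_mem F _ _).1 hx)
  exact ⟨y, hy.symm⟩

/-- Antidiagonal index of an entry. -/
def tm {k : ℕ} {μ : NPartition k} (T : YTableau μ) (a : Fin k) : ℕ := (T a).1.1 + (T a).1.2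

theorem tab_inj {k : ℕ} {μ : NPartition k} (T : YTableau μ) (p r : Equiv.Perm (Fin k))
    (hp : ∀ a, tm T (p a) = tm T a) (hr : ∀ a, tm T (r a) = tm T a)
    (hinj : ∀ y z, (T (p y)).1.1 = (T (p z)).1.1 → (T (r y)).1.2 = (T (r z)).1.2 → y = z) :
    p = r := by
  have key : ∀ t, ∀ y, tm T y = t → (T (p y)).1.1 = (T (r y)).1.1 := by
    intro t
    induction t using Nat.strong_induction_on with
    | _ t ih =>
    have hge : ∀ y, tm T y = t → (T (r y)).1.1 ≤ (T (p y)).1.1 := by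
      intro y hy
      by_contra hlt
      push Not at hlt
      set r' := (T (p y)).1.1 with hr'
      have hcell : (T (r y)).1.2 < μ.part r' :=
        lt_of_lt_of_le (T (r y)).2 (μ.antitone hlt.le)
      set x' := T.symm ⟨(r', (T (r y)).1.2), hcell⟩ with hx'
      have hTx : T x' = ⟨(r', (T (r y)).1.2), hcell⟩ := by simp [hx']
      set y' := r.symm x' with hy'
      have hry : r y' = x' := by simp [hy']
      have ht' : tm T y' < t := by
        rw [← hr y', hry, ← hy, ← hr y]
        simp only [tm, hTx]
        omega
      have h1 := ih _ ht' y' rfl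
      rw [hry, hTx] at h1
      have : y = y' := hinj y y' (by rw [h1]) (by rw [hry, hTx])
      rw [← this] at hry
      rw [← hry] at hTx
      rw [hTx] at hlt
      simp at hlt
    have hsum : ∀ s : Equiv.Perm (Fin k), (∀ a, tm T (s a) = tm T a) →
        ∑ y ∈ Finset.univ.filter (fun y => tm T y = t), (T (s y)).1.1
        = ∑ y ∈ Finset.univ.filter (fun y => tm T y = t), (T y).1.1 := by
      intro s hs
      refine Finset.sum_equiv s ?_ ?_
      · intro i; simp [hs]
      · intro i _; rfl
    intro y hy
    have heq := (Finset.sum_eq_sum_iff_of_le (s := Finset.univ.filter (fun y => tm T y = t))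
      (f := fun y => (T (r y)).1.1) (g := fun y => (T (p y)).1.1)
      (fun i hi => hge i (by simpa using hi))).1 ((hsum r hr).trans (hsum p hp).symm)
    exact (heq y (by simpa using hy)).symm
  ext1 y
  apply T.injective
  have h1 := key _ y rfl
  have h2 : tm T (p y) = tm T (r y) := by rw [hp, hr]
  apply Subtype.ext
  apply Prod.ext
  · exact h1
  · simp only [tm] at h2; omega

theorem count_bound {p q k : ℕ} (hpq : q + 1 = 2 * p) {μ : NPartition k}
    (hμ : ∀ j, j < p → μ.part j = q) (T : YTableau μ) :
    (p.factorial) ^ p ≤ Fintype.card {g : Equiv.Perm (Fin k) // tm T ∘ g = tm T} := by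
  rw [DomMulAct.stabilizer_card']
  have hcell : ∀ t, p - 1 ≤ t → t < 2 * p - 1 → ∀ i : Fin p, t - i.1 < μ.part i.1 := by
    intro t h1 h2 i
    rw [hμ _ i.2]
    have := i.2
    omega
  have hcard : ∀ t ∈ Finset.Ico (p - 1) (2 * p - 1),
      p ≤ Fintype.card {a // tm T a = t} := by
    intro t ht
    rw [Finset.mem_Ico] at ht
    have hinj : Function.Injective (fun i : Fin p =>
        (⟨T.symm ⟨(i.1, t - i.1), hcell t ht.1 ht.2 i⟩, by
          have := i.2
          simp only [tm, Equiv.apply_symm_apply]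
          omega⟩ : {a // tm T a = t})) := by
      intro i j hij
      simp only [Subtype.mk.injEq, EmbeddingLike.apply_eq_iff_eq, Prod.mk.injEq] at hij
      exact Fin.ext hij.1
    simpa using Fintype.card_le_of_injective _ hinj
  rcases Nat.eq_zero_or_pos p with hp0 | hp0
  · omega
  have hsub : Finset.Ico (p - 1) (2 * p - 1) ⊆ Finset.univ.image (tm T) := by
    intro t ht
    have := hcard t ht
    have h1 : 0 < Fintype.card {a // tm T a = t} := by omega
    obtain ⟨a, ha⟩ := Fintype.card_pos_iff.1 h1
    simp only [Finset.mem_image, Finset.mem_univ, true_and]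
    exact ⟨a, ha⟩
  calc p.factorial ^ p = ∏ _t ∈ Finset.Ico (p - 1) (2 * p - 1), p.factorial := by
        rw [Finset.prod_const, Nat.card_Ico]
        congr 1
        omega
    _ ≤ ∏ t ∈ Finset.Ico (p - 1) (2 * p - 1), (Fintype.card {a // tm T a = t}).factorial :=
        Finset.prod_le_prod' fun t ht => Nat.factorial_le (hcard t ht)
    _ ≤ _ := Finset.prod_le_prod_of_subset_of_one_le' hsub
        fun _ _ _ => Nat.factorial_pos _

theorem young_kill [CharZero F] {k : ℕ} {μ : NPartition k} (T : YTableau μ)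
    {W : Type*} [AddCommGroup W] [Module F W]
    (ρ : Representation F (Equiv.Perm (Fin k)) W) (V : Submodule F W) [Module.Finite F V]
    (hV : ∀ g, ∀ v ∈ V, ρ g v ∈ V)
    (hdim : Module.finrank F V < Fintype.card {g : Equiv.Perm (Fin k) // tm T ∘ g = tm T})
    (u : W) (hu : u ∈ V) : ρ.asAlgebraHom (youngSym F T) u = 0 := by
  by_contra hne
  let Ro : Module.End F W := ∑ σ ∈ Finset.univ.filter (· ∈ rowStab T), ρ σ
  let Co : Module.End F W := ∑ τ ∈ Finset.univ.filter (· ∈ colStab T),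
    (Equiv.Perm.sign τ : ℤ) • ρ τ
  have hRC : ρ.asAlgebraHom (youngSym F T) = Ro * Co := by
    simp only [youngSym, map_sum, map_zsmul, Representation.asAlgebraHom_single, one_smul, map_mul,
      Ro, Co, Finset.sum_mul_sum, mul_smul_comm]
  rw [hRC] at hne
  have hR : ∀ s ∈ rowStab T, Ro * ρ s = Ro := by
    intro s hs
    simp only [Ro, Finset.sum_mul, ← map_mul]
    refine Finset.sum_equiv (Equiv.mulRight s) ?_ ?_
    · intro σ
      simp only [Finset.mem_filter, Finset.mem_univ, true_and, Equiv.coe_mulRight]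
      replace hs : ∀ a, (T (s a)).1.1 = (T a).1.1 := hs
      change (∀ a, (T (σ a)).1.1 = (T a).1.1) ↔ (∀ a, (T (σ (s a))).1.1 = (T a).1.1)
      constructor
      · intro h a; rw [h, hs]
      · intro h a
        have := h (s⁻¹ a)
        have h2 := hs (s⁻¹ a)
        simp only [← Equiv.Perm.mul_apply, mul_inv_cancel, Equiv.Perm.one_apply] at this h2
        rw [this, h2]
    · intro σ _; simp
  have hC : ∀ s ∈ colStab T, Equiv.Perm.sign s = -1 → ρ s * Co = - Co := by
    intro s hs hsg
    simp only [Co, Finset.mul_sum, ← Finset.sum_neg_distrib]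
    refine Finset.sum_equiv (Equiv.mulLeft s) ?_ ?_
    · intro τ
      simp only [Finset.mem_filter, Finset.mem_univ, true_and, Equiv.coe_mulLeft]
      replace hs : ∀ a, (T (s a)).1.2 = (T a).1.2 := hs
      change (∀ a, (T (τ a)).1.2 = (T a).1.2) ↔ (∀ a, (T (s (τ a))).1.2 = (T a).1.2)
      simp only [hs]
    · intro τ _
      rw [Equiv.coe_mulLeft, map_mul, map_mul, hsg, mul_smul_comm]
      simp
  let X := {g : Equiv.Perm (Fin k) // tm T ∘ g = tm T}
  let vec : X → W := fun g => ρ g.1 (Co u)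
  have hvec : ∀ g, vec g ∈ V := by
    intro g
    refine hV _ _ ?_
    simp only [Co, LinearMap.sum_apply]
    refine V.sum_mem fun τ _ => ?_
    rw [LinearMap.smul_apply]
    exact zsmul_mem (hV _ _ hu) _
  have hz : ∀ g h : X, g ≠ h → Ro (ρ (h.1⁻¹) (vec g)) = 0 := by
    intro g h hgh
    have hinv : ∀ g : X, ∀ a, tm T (g.1⁻¹ a) = tm T a := by
      intro g a
      have := congrFun g.2 (g.1⁻¹ a)
      simpa using this.symm
    have : ∃ y z, (T (h.1⁻¹ y)).1.1 = (T (h.1⁻¹ z)).1.1 ∧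
        (T (g.1⁻¹ y)).1.2 = (T (g.1⁻¹ z)).1.2 ∧ y ≠ z := by
      by_contra hcon
      push Not at hcon
      apply hgh
      have := tab_inj T h.1⁻¹ g.1⁻¹ (hinv h) (hinv g) hcon
      exact Subtype.ext (inv_injective this.symm)
    obtain ⟨y, z, h1, h2, hyz⟩ := this
    have e1 : h.1⁻¹ * Equiv.swap y z = Equiv.swap (h.1⁻¹ y) (h.1⁻¹ z) * h.1⁻¹ :=
      Equiv.mul_swap_eq_swap_mul _ _ _
    have e2 : g.1 * Equiv.swap (g.1⁻¹ y) (g.1⁻¹ z) = Equiv.swap y z * g.1 := by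
      rw [Equiv.mul_swap_eq_swap_mul]; simp
    have m1 : Equiv.swap (h.1⁻¹ y) (h.1⁻¹ z) ∈ rowStab T := by
      intro a
      rw [Equiv.swap_apply_def]
      split_ifs with c1 c2
      · rw [c1, h1]
      · rw [c2, h1]
      · rfl
    have m2 : Equiv.swap (g.1⁻¹ y) (g.1⁻¹ z) ∈ colStab T := by
      intro a
      rw [Equiv.swap_apply_def]
      split_ifs with c1 c2
      · rw [c1, h2]
      · rw [c2, h2]
      · rfl
    have s2 : Equiv.Perm.sign (Equiv.swap (g.1⁻¹ y) (g.1⁻¹ z)) = -1 :=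
      Equiv.Perm.sign_swap (fun hh => hyz ((g.1⁻¹).injective hh))
    have main : Ro * ρ h.1⁻¹ * ρ g.1 * Co = -(Ro * ρ h.1⁻¹ * ρ g.1 * Co) := by
      calc Ro * ρ h.1⁻¹ * ρ g.1 * Co
          = Ro * ρ (Equiv.swap (h.1⁻¹ y) (h.1⁻¹ z)) * ρ h.1⁻¹ * ρ g.1 * Co := by rw [hR _ m1]
        _ = Ro * ρ (Equiv.swap (h.1⁻¹ y) (h.1⁻¹ z) * h.1⁻¹) * ρ g.1 * Co := by
            rw [map_mul]; simp only [mul_assoc]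
        _ = Ro * ρ h.1⁻¹ * ρ (Equiv.swap y z * g.1) * Co := by
            rw [← e1, map_mul, map_mul]; simp only [mul_assoc]
        _ = Ro * ρ h.1⁻¹ * ρ g.1 * (ρ (Equiv.swap (g.1⁻¹ y) (g.1⁻¹ z)) * Co) := by
            rw [← e2, map_mul]; simp only [mul_assoc]
        _ = _ := by rw [hC _ m2 s2, mul_neg]
    have hx : Ro (ρ (h.1⁻¹) (vec g)) = -Ro (ρ (h.1⁻¹) (vec g)) := by
      have := LinearMap.congr_fun main u
      simpa [vec] using this
    have h2 : (2 : F) • Ro (ρ (h.1⁻¹) (vec g)) = 0 := by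
      rw [two_smul]
      nth_rewrite 2 [hx]
      simp
    exact (smul_eq_zero.1 h2).resolve_left two_ne_zero
  have hd : ∀ g : X, Ro (ρ (g.1⁻¹) (vec g)) ≠ 0 := by
    intro g
    have : ρ (g.1⁻¹) (vec g) = Co u := by
      simp only [vec]
      rw [← Module.End.mul_apply, ← map_mul, inv_mul_cancel, map_one, Module.End.one_apply]
    rw [this]
    exact hne
  have hli : LinearIndependent F vec := by
    rw [Fintype.linearIndependent_iff]
    intro c hc h
    have := congrArg (fun w => Ro (ρ (h.1⁻¹) w)) hc
    simp only [map_sum, map_smul, map_zero] at this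
    rw [Finset.sum_eq_single h (fun g _ hg => by rw [hz g h hg, smul_zero]) (by simp)] at this
    exact (smul_eq_zero.1 this).resolve_right (hd h)
  have hli' : LinearIndependent F (fun g : X => (⟨vec g, hvec g⟩ : V)) :=
    LinearIndependent.of_comp V.subtype hli
  exact absurd hli'.fintype_card_le_finrank (not_le.2 hdim)

section Words

variable {ι : Type*} [LinearOrder ι]

theorem exists_colour (l : List ι) (hl : l.Nodup) :
    ∃ c : ι → ℕ, l.Pairwise (fun x y => c x = c y → x < y) ∧
      ∀ x ∈ l, ∃ s : List ι, (x :: s).Sublist l ∧ (x :: s).Pairwise (· > ·) ∧ s.length = c x := by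
  induction l with
  | nil => exact ⟨fun _ => 0, by simp, by simp⟩
  | cons x t ih =>
    rw [List.nodup_cons] at hl
    obtain ⟨c, h1, h2⟩ := ih hl.2
    let Y := t.toFinset.filter (· < x)
    let v := Y.sup (fun y => c y + 1)
    have hne : ∀ y ∈ t, y ≠ x := fun y hy h => hl.1 (h ▸ hy)
    have hc : ∀ y ∈ t, Function.update c x v y = c y := fun y hy =>
      Function.update_of_ne (hne y hy) _ _
    refine ⟨Function.update c x v, ?_, ?_⟩
    · rw [List.pairwise_cons]
      refine ⟨?_, ?_⟩
      · intro y hy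
        rw [hc y hy, Function.update_self]
        intro hv
        by_contra hlt
        have hyx : y < x := lt_of_le_of_ne (not_lt.1 hlt) (hne y hy)
        have : c y + 1 ≤ v := Finset.le_sup (f := fun y => c y + 1)
          (Finset.mem_filter.2 ⟨List.mem_toFinset.2 hy, hyx⟩)
        omega
      · refine h1.imp_of_mem ?_
        intro a b ha hb h
        rw [hc a ha, hc b hb]
        exact h
    · intro y hy
      rcases List.mem_cons.1 hy with rfl | hy
      · rw [Function.update_self]
        by_cases hY : Y.Nonempty
        · obtain ⟨z, hz, hzv⟩ := Finset.exists_mem_eq_sup Y hY (fun y => c y + 1)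
          have hz' := Finset.mem_filter.1 hz
          have hzt := List.mem_toFinset.1 hz'.1
          obtain ⟨s, hs1, hs2, hs3⟩ := h2 z hzt
          refine ⟨z :: s, hs1.cons_cons _, ?_, ?_⟩
          · rw [List.pairwise_cons]
            refine ⟨?_, hs2⟩
            intro w hw
            rcases List.mem_cons.1 hw with rfl | hw
            · exact hz'.2
            · exact lt_trans ((List.pairwise_cons.1 hs2).1 w hw) hz'.2
          · simp only [List.length_cons, hs3]
            exact hzv.symm
        · rw [Finset.not_nonempty_iff_eq_empty] at hY
          refine ⟨[], by simp, by simp, ?_⟩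
          simp [v, hY]
      · obtain ⟨s, hs1, hs2, hs3⟩ := h2 y hy
        exact ⟨s, hs1.cons _, hs2, by rw [hs3, hc y hy]⟩

/-- Words using each letter exactly once. -/
def IsWord (l : List ι) : Prop := l.Nodup ∧ ∀ s, s ∈ l

/-- Words with no decreasing subword of length `n`. -/
def GoodWord (n : ℕ) (l : List ι) : Prop :=
  IsWord l ∧ ∀ s : List ι, s.Sublist l → s.Pairwise (· > ·) → s.length ≠ n

theorem word_half (c : ι → ℕ) (l l' : List ι) (hl : l.Nodup)
    (hall' : ∀ s, s ∈ l') (hlen : l.length = l'.length)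
    (hp' : l'.Pairwise (fun x y => c x = c y → x < y))
    (hcc : ∀ i (h : i < l.length) (h' : i < l'.length), c l[i] = c l'[i])
    (i : ℕ) (h : i < l.length) (h' : i < l'.length)
    (ih : ∀ j, j < i → ∀ (h : j < l.length) (h' : j < l'.length), l[j] = l'[j])
    (hne : l[i] ≠ l'[i]) : l'[i] < l[i] := by
  obtain ⟨j, hj, hje⟩ := List.getElem_of_mem (hall' l[i])
  rcases lt_trichotomy j i with hji | hji | hji
  · exfalso
    have h1 := ih j hji (by omega) hj
    rw [hje] at h1
    have := (hl.getElem_inj_iff).1 h1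
    omega
  · subst hji
    exact absurd hje.symm hne
  · have := List.pairwise_iff_getElem.1 hp' i j h' hj hji
    rw [hje] at this
    exact this (hcc i h h').symm

theorem word_eq (c : ι → ℕ) (l l' : List ι) (hl : IsWord l) (hl' : IsWord l')
    (hlen : l.length = l'.length)
    (hp : l.Pairwise (fun x y => c x = c y → x < y))
    (hp' : l'.Pairwise (fun x y => c x = c y → x < y))
    (hcc : ∀ i (h : i < l.length) (h' : i < l'.length), c l[i] = c l'[i]) : l = l' := by
  have key : ∀ i, ∀ (h : i < l.length) (h' : i < l'.length), l[i] = l'[i] := by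
    intro i
    induction i using Nat.strong_induction_on with
    | _ i ih =>
    intro h h'
    by_contra hne
    have a1 := word_half c l l' hl.1 hl'.2 hlen hp' hcc i h h' ih hne
    have a2 := word_half c l' l hl'.1 hl.2 hlen.symm hp (fun i h h' => (hcc i h' h).symm) i h' h
      (fun j hj h h' => (ih j hj h' h).symm) (Ne.symm hne)
    exact lt_asymm a1 a2
  exact List.ext_getElem hlen key

theorem IsWord.length_eq [Fintype ι] {l : List ι} (hl : IsWord l) :
    l.length = Fintype.card ι := by
  rw [← List.toFinset_card_of_nodup hl.1, ← Finset.card_univ]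
  congr 1
  ext s
  simp [hl.2 s]

theorem good_card [Fintype ι] (n : ℕ) :
    Finite {l : List ι // GoodWord n l} ∧
      Nat.card {l : List ι // GoodWord n l} ≤ n ^ (2 * Fintype.card ι) := by
  have hlt : ∀ l : {l : List ι // GoodWord n l}, ∀ s : List ι, s.Sublist l.1 →
      s.Pairwise (· > ·) → s.length < n := by
    intro l s hs hd
    by_contra hcon
    push Not at hcon
    exact l.2.2 (s.take n) ((List.take_sublist _ _).trans hs) (hd.sublist (List.take_sublist _ _))
      (by simpa using hcon)
  have hex : ∀ l : {l : List ι // GoodWord n l}, ∃ c : ι → Fin n,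
      l.1.Pairwise (fun x y => (c x : ℕ) = c y → x < y) := by
    intro l
    obtain ⟨c, h1, h2⟩ := exists_colour l.1 l.2.1.1
    have hc : ∀ x, c x < n := by
      intro x
      obtain ⟨s, hs1, hs2, hs3⟩ := h2 x (l.2.1.2 x)
      have := hlt l _ hs1 hs2
      simp only [List.length_cons] at this
      omega
    exact ⟨fun x => ⟨c x, hc x⟩, h1⟩
  choose c hc using hex
  let f : {l : List ι // GoodWord n l} → (ι → Fin n) × (Fin (Fintype.card ι) → Fin n) :=
    fun l => (c l, fun i => c l (l.1[i.1]'(by rw [l.2.1.length_eq]; exact i.2)))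
  have hf : Function.Injective f := by
    intro l l' h
    have h1 : c l = c l' := congrArg Prod.fst h
    have h2 := congrArg Prod.snd h
    apply Subtype.ext
    refine word_eq (fun x => (c l x : ℕ)) l.1 l'.1 l.2.1 l'.2.1 ?_ (hc l) ?_ ?_
    · rw [l.2.1.length_eq, l'.2.1.length_eq]
    · rw [h1]; exact hc l'
    · intro i hi hi'
      have := congrFun h2 ⟨i, by rw [← l.2.1.length_eq]; exact hi⟩
      simp only [f] at this
      simp only [this]
      rw [h1]
  refine ⟨Finite.of_injective f hf, ?_⟩
  refine (Nat.card_le_card_of_injective f hf).trans ?_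
  simp only [Nat.card_eq_fintype_card, Fintype.card_prod, Fintype.card_fun, Fintype.card_fin]
  rw [← pow_add, two_mul]

theorem exists_blocks (ys l : List ι) (h : ys.Sublist l) :
    ∃ (u : List ι) (us : List (ι × List ι)), us.map Prod.fst = ys ∧
      l = u ++ (us.map (fun p => p.1 :: p.2)).flatten := by
  induction h with
  | slnil => exact ⟨[], [], by simp, by simp⟩
  | cons a _ ih =>
    obtain ⟨u, us, h1, h2⟩ := ih
    exact ⟨a :: u, us, h1, by simp [h2]⟩
  | cons_cons a _ ih =>
    obtain ⟨u, us, h1, h2⟩ := ih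
    exact ⟨[], (a, u) :: us, by simp [h1], by simp [h2]⟩

theorem exists_blocks_fin (n : ℕ) (ys l : List ι) (h : ys.Sublist l) (hd : ys.Pairwise (· > ·))
    (hn : ys.length = n) :
    ∃ (u : List ι) (y : Fin n → ι) (v : Fin n → List ι), (∀ i j, i < j → y j < y i) ∧
      l = u ++ (List.ofFn (fun i => y i :: v i)).flatten := by
  obtain ⟨u, us, h1, h2⟩ := exists_blocks ys l h
  subst h1
  rw [List.length_map] at hn
  subst hn
  refine ⟨u, fun i => us[i].1, fun i => us[i].2, ?_, ?_⟩
  · intro i j hij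
    have := List.pairwise_iff_getElem.1 hd i.1 j.1 (by simp) (by simp) hij
    simpa using this
  · rw [h2]
    congr 2
    apply List.ext_getElem
    · simp
    · intro i h1 h2
      simp

theorem block_lt (n : ℕ) (u : List ι) (y : Fin n → ι) (v : Fin n → List ι)
    (hy : ∀ i j, i < j → y j < y i) (σ : Equiv.Perm (Fin n)) (hσ : σ ≠ 1) :
    u ++ (List.ofFn (fun i => y (σ i) :: v (σ i))).flatten <
      u ++ (List.ofFn (fun i => y i :: v i)).flatten := by
  have hex : ∃ i : Fin n, σ i ≠ i := by
    by_contra hcon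
    push Not at hcon
    exact hσ (Equiv.ext hcon)
  obtain ⟨i, hi, hmin⟩ := WellFounded.has_min (wellFounded_lt (α := Fin n)) {i | σ i ≠ i} hex
  have hfix : ∀ j, j < i → σ j = j := by
    intro j hj
    by_contra hne
    exact hmin j hne hj
  have hlt : i < σ i := by
    rcases lt_trichotomy (σ i) i with h | h | h
    · exact absurd (σ.injective (hfix _ h)) hi
    · exact absurd h hi
    · exact h
  have hdec : ∀ f : Fin n → List ι, List.ofFn f =
      (List.ofFn f).take i ++ f i :: (List.ofFn f).drop (i + 1) := by
    intro f
    have h1 : i.1 < (List.ofFn f).length := by simp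
    conv_lhs => rw [← List.take_append_drop i.1 (List.ofFn f), List.drop_eq_getElem_cons h1]
    simp
  have htake : (List.ofFn (fun i => y (σ i) :: v (σ i))).take i
      = (List.ofFn (fun i => y i :: v i)).take i := by
    apply List.ext_getElem
    · simp
    · intro j h1 h2
      have hj : j < i.1 := by simp at h1; omega
      have := hfix ⟨j, by omega⟩ hj
      simp [this]
  rw [hdec (fun i => y (σ i) :: v (σ i)), hdec (fun i => y i :: v i), htake]
  simp only [List.flatten_append, List.flatten_cons, List.cons_append, ← List.append_assoc]
  apply List.append_left_lt
  exact List.Lex.rel (hy _ _ hlt)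

end Words

section Latyshev

variable {ι : Type*} [LinearOrder ι] [Fintype ι] {A X : Type*} [NonUnitalRing A] [Module F A]
    [SMulCommClass F A A] [IsScalarTower F A A]

theorem inr_listProd (l : List A) (hl : l ≠ []) :
    (Unitization.inr (listProd l) : Unitization F A) = (l.map Unitization.inr).prod := by
  induction l with
  | nil => exact absurd rfl hl
  | cons a t ih =>
    cases t with
    | nil => simp [listProd]
    | cons b t =>
      rw [listProd, Unitization.inr_mul, ih (by simp)]
      simp

/-- Evaluation of a word. -/
def wordFn (ev : X → ι → A) (l : List ι) : X → Unitization F A :=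
  fun x => (l.map (fun s => (Unitization.inr (ev x s) : Unitization F A))).prod

theorem latyshev (ev : X → ι → A) (n : ℕ) (hn : 1 ≤ n) (c : Equiv.Perm (Fin n) → F)
    (hc : c 1 ≠ 0)
    (hPI : ∀ a : Fin n → A, ∑ σ : Equiv.Perm (Fin n), c σ • finProd (fun i => a (σ i)) = 0)
    (l : List ι) (hl : IsWord l) :
    wordFn F ev l ∈ Submodule.span F
      (Set.range (fun l : {l : List ι // GoodWord n l} => wordFn F ev l.1)) := by
  by_contra hbad
  set V := Submodule.span F
      (Set.range (fun l : {l : List ι // GoodWord n l} => wordFn F ev l.1))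
  have hfin : {l : List ι | IsWord l ∧ wordFn F ev l ∉ V}.Finite :=
    (List.finite_length_eq ι (Fintype.card ι)).subset fun l hl => hl.1.length_eq
  obtain ⟨w, ⟨hw, hwV⟩, hmin⟩ := Set.exists_min_image _ id hfin ⟨l, hl, hbad⟩
  apply hwV
  by_cases hg : GoodWord n w
  · exact Submodule.subset_span ⟨⟨w, hg⟩, rfl⟩
  have : ∃ s : List ι, s.Sublist w ∧ s.Pairwise (· > ·) ∧ s.length = n := by
    by_contra hcon
    push Not at hcon
    exact hg ⟨hw, hcon⟩
  obtain ⟨s, hs1, hs2, hs3⟩ := this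
  obtain ⟨u, y, v, hy, hwe⟩ := exists_blocks_fin n s w hs1 hs2 hs3
  let wd : Equiv.Perm (Fin n) → List ι := fun σ =>
    u ++ (List.ofFn (fun i => y (σ i) :: v (σ i))).flatten
  have hwd1 : wd 1 = w := by simp [wd, hwe]
  have hperm : ∀ σ, (wd σ).Perm w := by
    intro σ
    rw [hwe]
    refine List.Perm.append_left _ (List.Perm.flatten ?_)
    exact Equiv.Perm.ofFn_comp_perm σ (fun i => y i :: v i)
  have hword : ∀ σ, IsWord (wd σ) := fun σ =>
    ⟨(hperm σ).nodup_iff.2 hw.1, fun s => (hperm σ).mem_iff.2 (hw.2 s)⟩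
  have hin : ∀ σ, σ ≠ 1 → wordFn F ev (wd σ) ∈ V := by
    intro σ hσ
    by_contra hcon
    have h1 := hmin (wd σ) ⟨hword σ, hcon⟩
    have h2 := block_lt n u y v hy σ hσ
    rw [← hwe] at h2
    exact absurd h1 (not_le.2 h2)
  have hsum : ∑ σ : Equiv.Perm (Fin n), c σ • wordFn F ev (wd σ) = 0 := by
    funext x
    let a : Fin n → A := fun i => listProd ((y i :: v i).map (ev x))
    have ha : ∀ i, (Unitization.inr (a i) : Unitization F A) =
        ((y i :: v i).map (fun s => (Unitization.inr (ev x s) : Unitization F A))).prod := by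
      intro i
      simp only [a]
      rw [inr_listProd F _ (by simp), List.map_map]
      rfl
    have hfp : ∀ σ : Equiv.Perm (Fin n),
        (Unitization.inr (finProd (fun i => a (σ i))) : Unitization F A) =
        (((List.ofFn (fun i => y (σ i) :: v (σ i))).flatten).map
          (fun s => (Unitization.inr (ev x s) : Unitization F A))).prod := by
      intro σ
      rw [finProd, inr_listProd F _ (by simp; omega), List.map_ofFn, List.map_flatten,
        List.prod_flatten, List.map_map, List.map_ofFn]
      congr 2
      funext i
      simp only [Function.comp]
      exact ha (σ i)
    have h0 := congrArg (fun z => (Unitization.inr z : Unitization F A)) (hPI a)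
    have h1 : ∑ σ : Equiv.Perm (Fin n), c σ •
        (Unitization.inr (finProd (fun i => a (σ i))) : Unitization F A) = 0 := by
      have h2 := map_sum (Unitization.inrHom F F A)
        (fun σ : Equiv.Perm (Fin n) => c σ • finProd (fun i => a (σ i))) Finset.univ
      rw [hPI a, map_zero] at h2
      simpa using h2.symm
    simp only [hfp] at h1
    simp only [Finset.sum_apply, Pi.smul_apply, wordFn, wd, List.map_append, List.prod_append,
      Pi.zero_apply]
    simp only [← mul_smul_comm]
    rw [← Finset.mul_sum, h1, mul_zero]
  rw [← Finset.add_sum_erase _ _ (Finset.mem_univ (1 : Equiv.Perm (Fin n))), hwd1] at hsum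
  have h3 : c 1 • wordFn F ev w ∈ V := by
    rw [eq_neg_of_add_eq_zero_left hsum]
    exact V.neg_mem (V.sum_mem fun σ hσ => V.smul_mem _ (hin σ (Finset.ne_of_mem_erase hσ)))
  exact (V.smul_mem_iff hc).1 h3

theorem word_space (ev : X → ι → A) (n : ℕ) (hn : 1 ≤ n) (c : Equiv.Perm (Fin n) → F)
    (hc : c 1 ≠ 0)
    (hPI : ∀ a : Fin n → A, ∑ σ : Equiv.Perm (Fin n), c σ • finProd (fun i => a (σ i)) = 0) :
    Module.Finite F (Submodule.span F (wordFn F ev '' {l | IsWord l})) ∧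
      Module.finrank F (Submodule.span F (wordFn F ev '' {l | IsWord l}))
        ≤ n ^ (2 * Fintype.card ι) := by
  obtain ⟨hf, hcard⟩ := good_card (ι := ι) n
  have := Fintype.ofFinite {l : List ι // GoodWord n l}
  have hle : Submodule.span F (wordFn F ev '' {l | IsWord l}) ≤ Submodule.span F
      (Set.range (fun l : {l : List ι // GoodWord n l} => wordFn F ev l.1)) := by
    rw [Submodule.span_le]
    rintro _ ⟨l, hl, rfl⟩
    exact latyshev F ev n hn c hc hPI l hl
  have hfd : Module.Finite F (Submodule.span F
      (Set.range (fun l : {l : List ι // GoodWord n l} => wordFn F ev l.1))) :=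
    Module.Finite.span_of_finite F (Set.finite_range _)
  refine ⟨Submodule.finiteDimensional_of_le hle, (Submodule.finrank_mono hle).trans ?_⟩
  refine (finrank_range_le_card _).trans ?_
  rw [← Nat.card_eq_fintype_card]
  exact hcard

end Latyshev

theorem exists_big (n : ℕ) :
    ∃ p : ℕ, 1 ≤ p ∧ n ^ (8 * p ^ 2) < p.factorial ^ p := by
  have h := FloorSemiring.tendsto_pow_div_factorial_atTop ((n : ℝ) ^ 8)
  have h1 := (h.eventually (gt_mem_nhds (zero_lt_one (α := ℝ)))).and
    (Filter.eventually_ge_atTop 1)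
  obtain ⟨p, hp, hp1⟩ := h1.exists
  refine ⟨p, hp1, ?_⟩
  have h2 : (0 : ℝ) < (p.factorial : ℝ) := by exact_mod_cast p.factorial_pos
  rw [div_lt_one h2] at hp
  have h3 : (n ^ 8) ^ p < p.factorial := by exact_mod_cast hp
  calc n ^ (8 * p ^ 2) = ((n ^ 8) ^ p) ^ p := by rw [← pow_mul, ← pow_mul]; ring_nf
    _ < _ := Nat.pow_lt_pow_left h3 (by omega)

theorem amitsur_core [CharZero F] {A : Type*} [NonUnitalRing A] [Module F A]
    [SMulCommClass F A A] [IsScalarTower F A A]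
    (n : ℕ) (hn : 1 ≤ n) (c : Equiv.Perm (Fin n) → F) (hc : c ≠ 0)
    (hPI : ∀ a : Fin n → A, ∑ σ : Equiv.Perm (Fin n), c σ • finProd (fun i => a (σ i)) = 0)
    {k : ℕ} {μ : NPartition k} (T : YTableau μ)
    (hdim : n ^ (2 * (2 * k + 1)) <
      Fintype.card {g : Equiv.Perm (Fin k) // tm T ∘ g = tm T})
    (a : Fin k → A) (b : Fin (k + 1) → Option A) :
    ∑ σ : Equiv.Perm (Fin k), idealChar F (youngSym F T) σ •
      listProd ((List.ofFn fun j : Fin k => (b j.castSucc).toList ++ [a (σ j)]).flatten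
        ++ (b (Fin.last _)).toList) = 0 := by
  obtain ⟨σ₀, hσ₀⟩ : ∃ σ, c σ ≠ 0 := by
    by_contra hcon
    push Not at hcon
    exact hc (funext hcon)
  have hPI' : ∀ a : Fin n → A,
      ∑ σ : Equiv.Perm (Fin n), c (σ₀ * σ) • finProd (fun i => a (σ i)) = 0 := by
    intro a
    have h := hPI (fun i => a (σ₀⁻¹ i))
    rw [← Equiv.sum_comp (Equiv.mulLeft σ₀)] at h
    simpa using h
  have hk0 : 0 < k := by
    rcases Nat.eq_zero_or_pos k with rfl | h
    · exfalso
      have h1 : Fintype.card {g : Equiv.Perm (Fin 0) // tm T ∘ g = tm T} ≤ 1 :=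
        (Fintype.card_subtype_le _).trans (by simp)
      have h2 : 1 ≤ n ^ (2 * (2 * 0 + 1)) := Nat.one_le_pow _ _ hn
      omega
    · exact h
  let J := {j : Fin (k + 1) // (b j).isSome}
  let ι := Fin k ⊕ J
  let : LinearOrder ι := LinearOrder.lift' (Fintype.equivFin ι) (Fintype.equivFin ι).injective
  let ev : (Fin k → A) → ι → A := fun x => Sum.elim x (fun j => (b j.1).get j.2)
  let V := Submodule.span F (wordFn F ev '' {l | IsWord l})
  obtain ⟨hfin, hrank⟩ := word_space F ev n hn (fun σ => c (σ₀ * σ)) (by simpa using hσ₀) hPI'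
  have hcardι : Fintype.card ι ≤ 2 * k + 1 := by
    have h1 : Fintype.card J ≤ k + 1 := (Fintype.card_subtype_le _).trans (by simp)
    have h2 : Fintype.card ι = k + Fintype.card J := by simp [ι]
    omega
  have hdim' : Module.finrank F V <
      Fintype.card {g : Equiv.Perm (Fin k) // tm T ∘ g = tm T} :=
    lt_of_le_of_lt (hrank.trans (Nat.pow_le_pow_right hn (by omega))) hdim
  let ρ : Representation F (Equiv.Perm (Fin k)) ((Fin k → A) → Unitization F A) :=
    { toFun := fun τ => LinearMap.funLeft F _ (fun x => x ∘ τ)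
      map_one' := rfl
      map_mul' := fun _ _ => rfl }
  have hρ : ∀ τ f x, ρ τ f x = f (x ∘ τ) := fun _ _ _ => rfl
  have hVinv : ∀ g, ∀ v ∈ V, ρ g v ∈ V := by
    intro g v hv
    have : V ≤ V.comap (ρ g) := by
      refine Submodule.span_le.2 ?_
      rintro _ ⟨l, hl, rfl⟩
      refine Submodule.subset_span ⟨l.map (Sum.map g id), ⟨?_, ?_⟩, ?_⟩
      · exact hl.1.map (Sum.map_injective.2 ⟨g.injective, Function.injective_id⟩)
      · intro s
        rw [List.mem_map]
        refine ⟨Sum.map g.symm id s, hl.2 _, ?_⟩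
        cases s <;> simp
      · funext x
        rw [hρ]
        simp only [wordFn, List.map_map]
        congr 2
        funext s
        rcases s with s | s <;> simp [ev]
    exact this hv
  let opt : Fin (k + 1) → List ι := fun j =>
    if h : (b j).isSome then [Sum.inr ⟨j, h⟩] else []
  let w : List ι := (List.ofFn fun j : Fin k => opt j.castSucc ++ [Sum.inl j]).flatten
    ++ opt (Fin.last _)
  have hoptm : ∀ j s, s ∈ opt j ↔ ∃ h, s = Sum.inr ⟨j, h⟩ := by
    intro j s
    simp only [opt]
    split_ifs with h
    · simp [h]
    · simp [h]
  have hoptn : ∀ j, (opt j).Nodup := by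
    intro j
    simp only [opt]
    split_ifs <;> simp
  have hoptev : ∀ x j, (opt j).map (ev x) = (b j).toList := by
    intro x j
    simp only [opt]
    split_ifs with h
    · obtain ⟨z, hz⟩ := Option.isSome_iff_exists.1 h
      simp [ev, hz]
    · simp only [Option.not_isSome_iff_eq_none] at h
      simp [h]
  have hw : IsWord w := by
    constructor
    · simp only [w]
      rw [List.nodup_append']
      refine ⟨?_, hoptn _, ?_⟩
      · rw [List.nodup_flatten]
        constructor
        · intro l hl
          rw [List.mem_ofFn] at hl
          obtain ⟨j, rfl⟩ := hl
          rw [List.nodup_append']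
          refine ⟨hoptn _, by simp, ?_⟩
          intro s hs hs'
          obtain ⟨h, rfl⟩ := (hoptm _ _).1 hs
          simp at hs'
        · rw [List.pairwise_ofFn]
          intro i j hij s hs hs'
          rw [List.mem_append, hoptm, List.mem_singleton] at hs hs'
          rcases hs with ⟨h, rfl⟩ | rfl <;> rcases hs' with ⟨h', hh⟩ | hh
          · have h3 := congrArg Subtype.val (Sum.inr.inj hh)
            have h4 := Fin.castSucc_injective _ h3
            omega
          · cases hh
          · cases hh
          · have h3 := Sum.inl.inj hh
            omega
      · intro s hs hs'
        obtain ⟨h, rfl⟩ := (hoptm _ _).1 hs'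
        rw [List.mem_flatten] at hs
        obtain ⟨l, hl, hs⟩ := hs
        rw [List.mem_ofFn] at hl
        obtain ⟨j, rfl⟩ := hl
        rw [List.mem_append, hoptm, List.mem_singleton] at hs
        rcases hs with ⟨h', hh⟩ | hh
        · have h3 := congrArg Subtype.val (Sum.inr.inj hh)
          exact absurd h3 (Fin.castSucc_lt_last j).ne'
        · cases hh
    · intro s
      simp only [w, List.mem_append, List.mem_flatten, List.mem_ofFn]
      rcases s with j | ⟨j, hj⟩
      · left
        exact ⟨_, ⟨j, rfl⟩, by simp⟩
      · rcases Fin.eq_castSucc_or_eq_last j with ⟨j', rfl⟩ | rfl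
        · left
          exact ⟨_, ⟨j', rfl⟩, List.mem_append.2 (Or.inl ((hoptm _ _).2 ⟨hj, rfl⟩))⟩
        · right
          exact (hoptm _ _).2 ⟨hj, rfl⟩
  have hwV : wordFn F ev w ∈ V := Submodule.subset_span ⟨w, hw, rfl⟩
  have hfinV : Module.Finite F V := hfin
  have hkill := idealChar_kill F ρ V hVinv (youngSym F T)
    (fun v hv => young_kill F T ρ V hVinv hdim' v hv) (wordFn F ev w) hwV
  have hval : ∀ σ : Equiv.Perm (Fin k), ρ σ (wordFn F ev w) a =
      (Unitization.inr (listProd ((List.ofFn fun j : Fin k =>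
        (b j.castSucc).toList ++ [a (σ j)]).flatten
        ++ (b (Fin.last _)).toList)) : Unitization F A) := by
    intro σ
    have hmap : w.map (ev (a ∘ σ)) = (List.ofFn fun j : Fin k =>
        (b j.castSucc).toList ++ [a (σ j)]).flatten ++ (b (Fin.last _)).toList := by
      simp only [w, List.map_append, List.map_flatten, List.map_ofFn, hoptev]
      congr 3
      funext j
      simp only [Function.comp, List.map_append, hoptev]
      simp [ev]
    rw [← hmap, inr_listProd F, List.map_map]
    · rfl
    · have : (Sum.inl ⟨0, hk0⟩ : ι) ∈ w := hw.2 _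
      intro hcon
      rw [List.map_eq_nil_iff] at hcon
      rw [hcon] at this
      simp at this
  have h0 := congrFun hkill a
  simp only [Finset.sum_apply, Pi.smul_apply, hval, Pi.zero_apply] at h0
  apply Unitization.inr_injective (R := F)
  have h2 := map_sum (Unitization.inrHom F F A)
    (fun σ : Equiv.Perm (Fin k) => idealChar F (youngSym F T) σ •
      listProd ((List.ofFn fun j : Fin k => (b j.castSucc).toList ++ [a (σ j)]).flatten
        ++ (b (Fin.last _)).toList)) Finset.univ
  simp only [map_smul, Unitization.inrHom_apply] at h2
  rw [h2, h0, Unitization.inr_zero]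

/-- **Corollary of Theorems 4.3 and 6.2.**

Every `#`-superalgebra over a field of characteristic zero which is a PI-algebra
satisfies the Amitsur `#`-superidentity of some rank
`⟨d,l⟩ = (d₁,l₁;d₂,l₂;d₃,l₃;d₄,l₄)`. -/
theorem satisfies_some_amitsur_identity
    (F A : Type*) [Field F] [CharZero F] [NonUnitalRing A] [Module F A]
    [SMulCommClass F A A] [IsScalarTower F A A] (S : SuperAlg F A) (hPI : IsPI F A) :
    ∃ d l : Fin 4 → ℕ, SatisfiesAmitsur S d l := by
  obtain ⟨n, hn, c, hc, hid⟩ := hPI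
  obtain ⟨p, hp, hfac⟩ := exists_big n
  refine ⟨fun _ => p - 1, fun _ => 2 * p - 2, ?_⟩
  intro i ν hν T a _ b _
  have hk : (p - 1 + 1) * (2 * p - 2 + 1) = p * (2 * p - 1) := by
    congr 1 <;> omega
  refine amitsur_core F n hn c hc hid T ?_ a b
  refine lt_of_lt_of_le ?_ (count_bound (p := p) (q := 2 * p - 2 + 1) (by omega)
    (fun j hj => hν j (by show j < p - 1 + 1; omega)) T)
  refine lt_of_le_of_lt (Nat.pow_le_pow_right hn ?_) hfac
  rw [hk]
  obtain ⟨r, rfl⟩ : ∃ r, p = r + 1 := ⟨p - 1, by omega⟩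
  have : 2 * (r + 1) - 1 = 2 * r + 1 := by omega
  rw [this]
  nlinarith

end SSA
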